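/- The family gamma -> (1/T^2 - gamma omega)/(1/T^2 - gamma(alpha omega)), indexed by Gamma~ = Gamma/{±I}, is multipliable, and its product u_alpha(1/T^2) satisfies |u_alpha(1/T^2) - (pi^4 + 2*pi^5)| < 3^{-5}, where pi = 1/T. (Part of the Proposition in Section 8.2 of the paper; this is the value at the cusp 1/T^2.) -/

import Mathlib

open Polynomial Matrix
open scoped Classical

/-- The absolute value on `K_∞ = F₃((π))`: `|x| = 3^{-v_∞(x)}`. -/
noncomputable def absK3 (x : LaurentSeries (ZMod 3)) : ℝ :=
  if x = 0 then 0 else (3 : ℝ) ^ (-(HahnSeries.order x))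

/-- The element `T = π⁻¹` of `K_∞ = F₃((π))`. -/
noncomputable def Tel3 : LaurentSeries (ZMod 3) :=
  HahnSeries.single (-1 : ℤ) 1

/-- The embedding `A = F₃[T] → C`, sending `T` to `π⁻¹`. -/
noncomputable def polyEmb3 (C : Type*) [NormedField C]
    [Algebra (LaurentSeries (ZMod 3)) C] : Polynomial (ZMod 3) →+* C :=
  (algebraMap (LaurentSeries (ZMod 3)) C).comp (Polynomial.aeval Tel3).toRingHom

/-- The action of a matrix over `A = F₃[T]` on `C` by fractional linear
transformations. -/
noncomputable def act3 {C : Type*} [NormedField C] [Algebra (LaurentSeries (ZMod 3)) C]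
    (g : Matrix (Fin 2) (Fin 2) (Polynomial (ZMod 3))) (z : C) : C :=
  (polyEmb3 C (g 0 0) * z + polyEmb3 C (g 0 1)) /
    (polyEmb3 C (g 1 0) * z + polyEmb3 C (g 1 1))

/-- `Γ = Γ₀(T³-T²) = {[[a,b],[c,d]] : a,b,c,d ∈ F₃[T], ad-bc ∈ F₃ˣ, (T³-T²) ∣ c}`. -/
def Gamma0TTT : Set (Matrix (Fin 2) (Fin 2) (Polynomial (ZMod 3))) :=
  {g | (∃ u : ZMod 3, u ≠ 0 ∧ g.det = Polynomial.C u) ∧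
    ((Polynomial.X : Polynomial (ZMod 3)) ^ 3 - Polynomial.X ^ 2) ∣ g 1 0}

/-- The matrix `α = [[T³+2T²+2T+2, 2T+1],[T⁴+T³+T², 2T²+2T+1]] ∈ Γ₀(T³-T²)`. -/
noncomputable def alpha3 : Matrix (Fin 2) (Fin 2) (Polynomial (ZMod 3)) :=
  !![Polynomial.X ^ 3 + 2 * Polynomial.X ^ 2 + 2 * Polynomial.X + 2, 2 * Polynomial.X + 1;
     Polynomial.X ^ 4 + Polynomial.X ^ 3 + Polynomial.X ^ 2, 2 * Polynomial.X ^ 2 + 2 * Polynomial.X + 1]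

/-- The equivalence relation on `Γ` identifying `γ` and `-γ`;  the quotient
`Quotient pmSetoid` is `Γ~ = Γ/{±I}`. -/
def pmSetoid : Setoid ↥Gamma0TTT where
  r γ δ := δ.val = γ.val ∨ δ.val = -γ.val
  iseqv := by
    constructor
    · intro γ
      exact Or.inl rfl
    · rintro γ δ (h | h)
      · exact Or.inl h.symm
      · exact Or.inr (by rw [h, neg_neg])
    · rintro γ δ ε (h | h) (h' | h')
      · exact Or.inl (h'.trans h)
      · exact Or.inr (by rw [h', h])
      · exact Or.inr (h'.trans h)
      · exact Or.inl (by rw [h', h, neg_neg])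


section Analysis

variable {𝕂 : Type*} [NormedField 𝕂]

theorem norm_sum_le_of_ultrametric (hna : ∀ x y : 𝕂, ‖x + y‖ ≤ max ‖x‖ ‖y‖) {ι : Type*}
    (s : Finset ι) (g : ι → 𝕂) {r : ℝ} (hr : 0 ≤ r) (hg : ∀ i ∈ s, ‖g i‖ ≤ r) :
    ‖∑ i ∈ s, g i‖ ≤ r := by
  induction s using Finset.induction_on with
  | empty => simpa using hr
  | insert a s ha ih =>
    rw [Finset.sum_insert ha]
    exact (hna _ _).trans (max_le (hg a (by simp)) (ih fun i hi => hg i (by simp [hi])))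

theorem norm_sub_le_of_ultrametric (hna : ∀ x y : 𝕂, ‖x + y‖ ≤ max ‖x‖ ‖y‖) (x y : 𝕂) :
    ‖x - y‖ ≤ max ‖x‖ ‖y‖ := by
  simpa [sub_eq_add_neg] using hna x (-y)

theorem norm_prod_sub_one_le (hna : ∀ x y : 𝕂, ‖x + y‖ ≤ max ‖x‖ ‖y‖) {ι : Type*}
    (s : Finset ι) (g : ι → 𝕂) {δ : ℝ} (h0 : 0 ≤ δ) (h1 : δ ≤ 1)
    (hg : ∀ i ∈ s, ‖g i - 1‖ ≤ δ) : ‖∏ i ∈ s, g i - 1‖ ≤ δ := by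
  induction s using Finset.induction_on with
  | empty => simpa using h0
  | insert a s ha ih =>
    rw [Finset.prod_insert ha]
    have h2 := ih fun i hi => hg i (by simp [hi])
    have h3 := hg a (by simp)
    have h4 : g a * ∏ i ∈ s, g i - 1
        = (g a - 1) * (∏ i ∈ s, g i - 1) + ((g a - 1) + (∏ i ∈ s, g i - 1)) := by ring
    rw [h4]
    refine (hna _ _).trans (max_le ?_ ((hna _ _).trans (max_le h3 h2)))
    rw [norm_mul]
    nlinarith [norm_nonneg (g a - 1), norm_nonneg (∏ i ∈ s, g i - 1)]

theorem norm_prod_sub_prod_le (hna : ∀ x y : 𝕂, ‖x + y‖ ≤ max ‖x‖ ‖y‖) {ι : Type*}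
    {s t : Finset ι} (hst : s ⊆ t) (g : ι → 𝕂) {δ : ℝ} (h0 : 0 ≤ δ) (h1 : δ ≤ 1)
    (hg : ∀ i ∉ s, ‖g i - 1‖ ≤ δ) :
    ‖∏ i ∈ t, g i - ∏ i ∈ s, g i‖ ≤ ‖∏ i ∈ s, g i‖ * δ := by
  have h2 : ∏ i ∈ t, g i - ∏ i ∈ s, g i = (∏ i ∈ s, g i) * (∏ i ∈ t \ s, g i - 1) := by
    rw [← Finset.prod_sdiff hst]; ring
  rw [h2, norm_mul]
  gcongr
  exact norm_prod_sub_one_le hna _ g h0 h1 fun i hi => hg i (Finset.mem_sdiff.1 hi).2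

/-- In a complete ultrametric field, a product whose factors tend to `1` converges, and is
approximated by a finite partial product up to the relative error of the omitted factors. -/
theorem multipliable_and_norm_tprod_sub_prod_le [CompleteSpace 𝕂]
    (hna : ∀ x y : 𝕂, ‖x + y‖ ≤ max ‖x‖ ‖y‖) {ι : Type*} (g : ι → 𝕂)
    (hfin : ∀ ε : ℝ, 0 < ε → {i | ε < ‖g i - 1‖}.Finite)
    (s : Finset ι) {δ : ℝ} (h0 : 0 ≤ δ) (h1 : δ ≤ 1) (hg : ∀ i ∉ s, ‖g i - 1‖ ≤ δ) :
    Multipliable g ∧ ‖∏' i, g i - ∏ i ∈ s, g i‖ ≤ ‖∏ i ∈ s, g i‖ * δ := by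
  have hbound : ∀ t, s ⊆ t → ‖∏ i ∈ t, g i‖ ≤ ‖∏ i ∈ s, g i‖ := by
    intro t hst
    have h2 : ∏ i ∈ t, g i = (∏ i ∈ t, g i - ∏ i ∈ s, g i) + ∏ i ∈ s, g i := by ring
    rw [h2]
    refine (hna _ _).trans (max_le ((norm_prod_sub_prod_le hna hst g h0 h1 hg).trans ?_) le_rfl)
    exact mul_le_of_le_one_right (norm_nonneg _) h1
  have hcauchy : CauchySeq fun t : Finset ι => ∏ i ∈ t, g i := by
    rw [Metric.cauchySeq_iff']
    intro ε hε
    set M := ‖∏ i ∈ s, g i‖ + 1 with hM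
    have hMpos : 0 < M := by positivity
    set η := min 1 (ε / (2 * M)) with hη
    have hηpos : 0 < η := by positivity
    refine ⟨s ∪ (hfin η hηpos).toFinset, fun t ht => ?_⟩
    rw [dist_eq_norm]
    refine (norm_prod_sub_prod_le hna ht g hηpos.le (min_le_left _ _) ?_).trans_lt ?_
    · intro i hi
      by_contra hlt
      exact hi (by simp [not_le.1 hlt])
    · have h3 := hbound (s ∪ (hfin η hηpos).toFinset) Finset.subset_union_left
      calc _ ≤ M * (ε / (2 * M)) := by
            gcongr
            · linarith
            · exact min_le_right _ _
        _ = ε / 2 := by field_simp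
        _ < ε := by linarith
  obtain ⟨a, ha⟩ := cauchySeq_tendsto_of_complete hcauchy
  have hprod : HasProd g a := ha
  refine ⟨hprod.multipliable, ?_⟩
  rw [hprod.tprod_eq]
  refine le_of_tendsto ((ha.sub_const _).norm) ?_
  filter_upwards [Filter.eventually_ge_atTop s] with t ht
  exact norm_prod_sub_prod_le hna ht g h0 h1 hg

theorem norm_eq_one_of_sq_add_one {ρ : 𝕂} (hρ : ρ ^ 2 + 1 = 0) : ‖ρ‖ = 1 := by
  have : ‖ρ‖ ^ 2 = 1 := by rw [← norm_pow, eq_neg_of_add_eq_zero_left hρ]; simp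
  exact (pow_eq_one_iff_of_nonneg (norm_nonneg _) two_ne_zero).1 this

end Analysis

section Embedding

variable {𝕂 : Type*} [NormedField 𝕂] [Algebra (LaurentSeries (ZMod 3)) 𝕂]

theorem polyEmb3_X : polyEmb3 𝕂 X = algebraMap (LaurentSeries (ZMod 3)) 𝕂 Tel3 := by
  simp [polyEmb3]

theorem norm_polyEmb3_X
    (hext : ∀ x : LaurentSeries (ZMod 3), ‖algebraMap (LaurentSeries (ZMod 3)) 𝕂 x‖ = absK3 x) :
    ‖polyEmb3 𝕂 X‖ = 3 := by
  rw [polyEmb3_X, hext, absK3, Tel3, if_neg (by simp), HahnSeries.order_single (by simp)]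
  norm_num

theorem norm_polyEmb3_C {a : ZMod 3} (ha : a ≠ 0) : ‖polyEmb3 𝕂 (Polynomial.C a)‖ = 1 := by
  have h : a ^ 2 = 1 := by revert a; decide
  have h2 : ‖polyEmb3 𝕂 (Polynomial.C a)‖ ^ 2 = 1 := by
    rw [← norm_pow, ← map_pow, ← map_pow, h]; simp
  exact (pow_eq_one_iff_of_nonneg (norm_nonneg _) two_ne_zero).1 h2

theorem norm_polyEmb3_le (hna : ∀ x y : 𝕂, ‖x + y‖ ≤ max ‖x‖ ‖y‖)
    (hext : ∀ x : LaurentSeries (ZMod 3), ‖algebraMap (LaurentSeries (ZMod 3)) 𝕂 x‖ = absK3 x)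
    {p : (ZMod 3)[X]} {k : ℕ} (hp : p.natDegree ≤ k) : ‖polyEmb3 𝕂 p‖ ≤ 3 ^ k := by
  rw [p.as_sum_range_C_mul_X_pow, map_sum]
  refine norm_sum_le_of_ultrametric hna _ _ (by positivity) fun i hi => ?_
  rw [map_mul, map_pow, norm_mul, norm_pow, norm_polyEmb3_X hext]
  have h1 : ‖polyEmb3 𝕂 (Polynomial.C (p.coeff i))‖ ≤ 1 := by
    by_cases h : p.coeff i = 0
    · simp [h]
    · exact (norm_polyEmb3_C h).le
  have h2 : i ≤ k := by have := Finset.mem_range.1 hi; omega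
  calc _ ≤ 1 * (3 : ℝ) ^ k := by gcongr; norm_num
    _ = _ := one_mul _

theorem norm_polyEmb3 (hna : ∀ x y : 𝕂, ‖x + y‖ ≤ max ‖x‖ ‖y‖)
    (hext : ∀ x : LaurentSeries (ZMod 3), ‖algebraMap (LaurentSeries (ZMod 3)) 𝕂 x‖ = absK3 x)
    {p : (ZMod 3)[X]} {k : ℕ} (hp : p.natDegree ≤ k) (hk : p.coeff k ≠ 0) :
    ‖polyEmb3 𝕂 p‖ = 3 ^ k := by
  refine le_antisymm (norm_polyEmb3_le hna hext hp) ?_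
  set m : (ZMod 3)[X] := Polynomial.C (p.coeff k) * X ^ k with hm
  have hnm : ‖polyEmb3 𝕂 m‖ = 3 ^ k := by
    rw [hm, map_mul, map_pow, norm_mul, norm_pow, norm_polyEmb3_X hext, norm_polyEmb3_C hk, one_mul]
  rcases Nat.eq_zero_or_pos k with rfl | hpos
  · have : p = m := by rw [hm, pow_zero, mul_one]; exact eq_C_of_natDegree_le_zero hp
    rw [this, hnm]
  have hr : (p - m).natDegree ≤ k - 1 := by
    rw [natDegree_le_iff_coeff_eq_zero]
    intro j hj
    rw [coeff_sub, hm, coeff_C_mul_X_pow]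
    rcases eq_or_ne j k with rfl | hjk
    · simp
    · rw [if_neg hjk, coeff_eq_zero_of_natDegree_lt (by omega), sub_zero]
  have hlt : (3 : ℝ) ^ (k - 1) < 3 ^ k := by gcongr <;> [norm_num; omega]
  have h1 := norm_polyEmb3_le hna hext hr
  have h2 : ‖polyEmb3 𝕂 m‖ ≤ max ‖polyEmb3 𝕂 p‖ ‖polyEmb3 𝕂 (p - m)‖ := by
    have : polyEmb3 𝕂 m = polyEmb3 𝕂 p - polyEmb3 𝕂 (p - m) := by rw [map_sub]; ring
    rw [this]; exact norm_sub_le_of_ultrametric hna _ _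
  rcases le_max_iff.1 h2 with h | h
  · rwa [hnm] at h
  · linarith

/-- The value `Pρ + Q` of the linear form with coefficients `P`, `Q`. -/
noncomputable def linForm (ρ : 𝕂) (P Q : (ZMod 3)[X]) : 𝕂 := polyEmb3 𝕂 P * ρ + polyEmb3 𝕂 Q

theorem norm_linForm_le (hna : ∀ x y : 𝕂, ‖x + y‖ ≤ max ‖x‖ ‖y‖)
    (hext : ∀ x : LaurentSeries (ZMod 3), ‖algebraMap (LaurentSeries (ZMod 3)) 𝕂 x‖ = absK3 x)
    {ρ : 𝕂} (hρ : ρ ^ 2 + 1 = 0) {P Q : (ZMod 3)[X]} {k : ℕ}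
    (hP : P.natDegree ≤ k) (hQ : Q.natDegree ≤ k) : ‖linForm ρ P Q‖ ≤ 3 ^ k := by
  refine (hna _ _).trans (max_le ?_ (norm_polyEmb3_le hna hext hQ))
  rw [norm_mul, norm_eq_one_of_sq_add_one hρ, mul_one]
  exact norm_polyEmb3_le hna hext hP

/-- Since `-1` is not a square in `𝔽₃`, there is no cancellation in `Pρ + Q`. -/
theorem norm_linForm (hna : ∀ x y : 𝕂, ‖x + y‖ ≤ max ‖x‖ ‖y‖)
    (hext : ∀ x : LaurentSeries (ZMod 3), ‖algebraMap (LaurentSeries (ZMod 3)) 𝕂 x‖ = absK3 x)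
    {ρ : 𝕂} (hρ : ρ ^ 2 + 1 = 0) {P Q : (ZMod 3)[X]} {k : ℕ}
    (hP : P.natDegree ≤ k) (hQ : Q.natDegree ≤ k) (h : P.coeff k ≠ 0 ∨ Q.coeff k ≠ 0) :
    ‖linForm ρ P Q‖ = 3 ^ k := by
  have h1 := norm_linForm_le hna hext hρ hP hQ
  have h2 := norm_linForm_le hna hext hρ (P := -P) (by simpa using hP) hQ
  have hmul : linForm ρ P Q * linForm ρ (-P) Q = polyEmb3 𝕂 (P ^ 2 + Q ^ 2) := by
    simp only [linForm, map_neg, map_add, map_pow]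
    linear_combination (-(polyEmb3 𝕂 P) ^ 2) * hρ
  have hc : (P ^ 2 + Q ^ 2).coeff (2 * k) ≠ 0 := by
    rw [coeff_add, coeff_pow_of_natDegree_le hP, coeff_pow_of_natDegree_le hQ]
    generalize P.coeff k = x at h
    generalize Q.coeff k = y at h
    revert x y; decide
  have hd : (P ^ 2 + Q ^ 2).natDegree ≤ 2 * k :=
    natDegree_add_le_of_degree_le (natDegree_pow_le_of_le 2 hP) (natDegree_pow_le_of_le 2 hQ)
  have hn := norm_polyEmb3 (𝕂 := 𝕂) hna hext hd hc
  rw [← hmul, norm_mul, two_mul, pow_add] at hn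
  refine le_antisymm h1 ?_
  have hpos : (0 : ℝ) < 3 ^ k := by positivity
  by_contra hlt
  nlinarith [norm_nonneg (linForm ρ P Q)]

theorem norm_linForm_max (hna : ∀ x y : 𝕂, ‖x + y‖ ≤ max ‖x‖ ‖y‖)
    (hext : ∀ x : LaurentSeries (ZMod 3), ‖algebraMap (LaurentSeries (ZMod 3)) 𝕂 x‖ = absK3 x)
    {ρ : 𝕂} (hρ : ρ ^ 2 + 1 = 0) {P Q : (ZMod 3)[X]} (h : P ≠ 0 ∨ Q ≠ 0) :
    ‖linForm ρ P Q‖ = 3 ^ max P.natDegree Q.natDegree := by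
  refine norm_linForm hna hext hρ (le_max_left _ _) (le_max_right _ _) ?_
  rcases le_total P.natDegree Q.natDegree with hle | hle
  · rw [max_eq_right hle]
    by_cases hQ : Q = 0
    · have hP := h.resolve_right (not_not.2 hQ)
      subst hQ
      rw [natDegree_zero] at hle ⊢
      left
      simpa [← Nat.le_zero.1 hle] using hP
    · right; simpa using hQ
  · rw [max_eq_left hle]
    by_cases hP : P = 0
    · have hQ := h.resolve_left (not_not.2 hP)
      subst hP
      rw [natDegree_zero] at hle ⊢
      right
      simpa [← Nat.le_zero.1 hle] using hQ
    · left; simpa using hP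

end Embedding

section ListPoly

/-- The polynomial with the given list of coefficients, lowest degree first. -/
noncomputable def listPoly : List (ZMod 3) → (ZMod 3)[X]
  | [] => 0
  | a :: l => Polynomial.C a + X * listPoly l

/-- Addition of coefficient lists. -/
def listAdd : List (ZMod 3) → List (ZMod 3) → List (ZMod 3)
  | [], m => m
  | a :: l, [] => a :: l
  | a :: l, b :: m => (a + b) :: listAdd l m

/-- Negation of coefficient lists. -/
def listNeg : List (ZMod 3) → List (ZMod 3)
  | [] => []
  | a :: l => -a :: listNeg l

/-- Multiplication of a coefficient list by a scalar. -/
def listSmul (a : ZMod 3) : List (ZMod 3) → List (ZMod 3)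
  | [] => []
  | b :: l => a * b :: listSmul a l

/-- Multiplication of coefficient lists. -/
def listMul : List (ZMod 3) → List (ZMod 3) → List (ZMod 3)
  | [], _ => []
  | a :: l, m => listAdd (listSmul a m) (0 :: listMul l m)

/-- Subtraction of coefficient lists. -/
def listSub (l m : List (ZMod 3)) : List (ZMod 3) := listAdd l (listNeg m)

theorem listPoly_add (l m : List (ZMod 3)) :
    listPoly (listAdd l m) = listPoly l + listPoly m := by
  induction l generalizing m with
  | nil => simp [listAdd, listPoly]
  | cons a l ih =>
    cases m with
    | nil => simp [listAdd, listPoly]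
    | cons b m => simp only [listAdd, listPoly, ih, map_add]; ring

theorem listPoly_neg (l : List (ZMod 3)) : listPoly (listNeg l) = -listPoly l := by
  induction l with
  | nil => simp [listNeg, listPoly]
  | cons a l ih => simp only [listNeg, listPoly, ih, map_neg]; ring

theorem listPoly_smul (a : ZMod 3) (l : List (ZMod 3)) :
    listPoly (listSmul a l) = Polynomial.C a * listPoly l := by
  induction l with
  | nil => simp [listSmul, listPoly]
  | cons b l ih => simp only [listSmul, listPoly, ih, map_mul]; ring

theorem listPoly_mul (l m : List (ZMod 3)) :
    listPoly (listMul l m) = listPoly l * listPoly m := by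
  induction l with
  | nil => simp [listMul, listPoly]
  | cons a l ih =>
    simp only [listMul, listPoly, ih, listPoly_add, listPoly_smul, map_zero]; ring

theorem listPoly_sub (l m : List (ZMod 3)) :
    listPoly (listSub l m) = listPoly l - listPoly m := by
  rw [listSub, listPoly_add, listPoly_neg, sub_eq_add_neg]

theorem coeff_listPoly (l : List (ZMod 3)) (k : ℕ) : (listPoly l).coeff k = l.getD k 0 := by
  induction l generalizing k with
  | nil => simp [listPoly]
  | cons a l ih =>
    cases k with
    | zero => simp [listPoly]
    | succ k => simp [listPoly, ih]

theorem natDegree_listPoly_le {l : List (ZMod 3)} {k : ℕ} (h : l.length ≤ k + 1) :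
    (listPoly l).natDegree ≤ k := by
  rw [natDegree_le_iff_coeff_eq_zero]
  intro j hj
  rw [coeff_listPoly, List.getD_eq_default _ _ (by omega)]

theorem listPoly_eq_zero_iff (l : List (ZMod 3)) : listPoly l = 0 ↔ ∀ a ∈ l, a = 0 := by
  induction l with
  | nil => simp [listPoly]
  | cons a l ih =>
    rw [List.forall_mem_cons, ← ih]
    constructor
    · intro h
      have ha : a = 0 := by simpa [coeff_listPoly] using congrArg (coeff · 0) h
      refine ⟨ha, ?_⟩
      simpa [listPoly, ha] using h
    · rintro ⟨rfl, h⟩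
      simp [listPoly, h]

theorem listPoly_eq_iff (l m : List (ZMod 3)) :
    listPoly l = listPoly m ↔ ∀ a ∈ listSub l m, a = 0 := by
  rw [← listPoly_eq_zero_iff, listPoly_sub, sub_eq_zero]

theorem eq_listPoly_of_natDegree_le {p : (ZMod 3)[X]} {k : ℕ} (h : p.natDegree ≤ k) :
    p = listPoly ((List.range (k + 1)).map p.coeff) := by
  ext j
  rw [coeff_listPoly, List.getD_eq_getElem?_getD, List.getElem?_map]
  rcases lt_or_ge j (k + 1) with hj | hj
  · simp [List.getElem?_range hj]
  · rw [coeff_eq_zero_of_natDegree_lt (by omega), List.getElem?_eq_none (by simpa using hj)]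
    simp

end ListPoly

section RowData

/-- Coefficients of the top left entry of the conjugate `β` of `α` by `diag(T², 1)`. -/
def beta11 : List (ZMod 3) := [2, 2, 2, 1]

/-- Coefficients of the top right entry of `β`. -/
def beta12 : List (ZMod 3) := [0, 0, 1, 2]

/-- Coefficients of the bottom left entry of `β`. -/
def beta21 : List (ZMod 3) := [1, 1, 1]

/-- Coefficients of the bottom right entry of `β`. -/
def beta22 : List (ZMod 3) := [1, 2, 2]

/-- First entry of the row vector `(P, Q) β`. -/
noncomputable def betaFst (P Q : (ZMod 3)[X]) : (ZMod 3)[X] :=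
  P * listPoly beta11 + Q * listPoly beta21

/-- Second entry of the row vector `(P, Q) β`. -/
noncomputable def betaSnd (P Q : (ZMod 3)[X]) : (ZMod 3)[X] :=
  P * listPoly beta12 + Q * listPoly beta22

theorem det_beta :
    listPoly beta11 * listPoly beta22 - listPoly beta12 * listPoly beta21 = -1 := by
  have h : (-1 : (ZMod 3)[X]) = listPoly [-1] := by simp [listPoly]
  rw [h, ← listPoly_mul, ← listPoly_mul, ← listPoly_sub, listPoly_eq_iff]
  decide

theorem alpha3_zero_zero : alpha3 0 0 = listPoly beta11 := by
  simp [alpha3, beta11, listPoly, map_ofNat]; ring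

theorem X_sq_mul_alpha3_zero_one : X ^ 2 * alpha3 0 1 = listPoly beta12 := by
  simp [alpha3, beta12, listPoly, map_ofNat]; ring

theorem alpha3_one_zero : alpha3 1 0 = X ^ 2 * listPoly beta21 := by
  simp [alpha3, beta21, listPoly]; ring

theorem alpha3_one_one : alpha3 1 1 = listPoly beta22 := by
  simp [alpha3, beta22, listPoly, map_ofNat]; ring

/-- The bottom left entry of the conjugate of `g` by `diag(T², 1)`, when `T²` divides `g 1 0`. -/
noncomputable def lowEntry (g : Matrix (Fin 2) (Fin 2) (ZMod 3)[X]) : (ZMod 3)[X] :=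
  (g 1 0).divX.divX

/-- With `relFst g` and `relSnd g`, the row `(1/T², -1) g` becomes, up to scaling,
`(relFst g, relSnd g)` in the coordinates conjugated by `diag(T², 1)`. -/
noncomputable def relFst (g : Matrix (Fin 2) (Fin 2) (ZMod 3)[X]) : (ZMod 3)[X] :=
  lowEntry g - g 0 0

/-- See `relFst`. -/
noncomputable def relSnd (g : Matrix (Fin 2) (Fin 2) (ZMod 3)[X]) : (ZMod 3)[X] :=
  g 1 1 - X ^ 2 * g 0 1

/-- The two rows, attached to the factor indexed by `g`, which control its distance to `1`. -/
noncomputable def rowData (g : Matrix (Fin 2) (Fin 2) (ZMod 3)[X]) :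
    (ZMod 3)[X] × (ZMod 3)[X] × (ZMod 3)[X] × (ZMod 3)[X] :=
  (lowEntry g, g 1 1, betaFst (relFst g) (relSnd g), betaSnd (relFst g) (relSnd g))

theorem lowEntry_eq {g : Matrix (Fin 2) (Fin 2) (ZMod 3)[X]} {P : (ZMod 3)[X]}
    (h : g 1 0 = X ^ 2 * P) : lowEntry g = P := by
  have h1 : g 1 0 = P * X * X := by rw [h]; ring
  ext n
  rw [lowEntry, coeff_divX, coeff_divX, h1, coeff_mul_X, coeff_mul_X]

theorem exists_of_mem_Gamma0TTT {g : Matrix (Fin 2) (Fin 2) (ZMod 3)[X]} (hg : g ∈ Gamma0TTT) :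
    g 1 0 = X ^ 2 * lowEntry g ∧ (lowEntry g).eval 1 = 0 ∧
      ∃ u : ZMod 3, u ≠ 0 ∧
        relSnd g * lowEntry g - relFst g * g 1 1 = Polynomial.C u := by
  obtain ⟨⟨u, hu, hdet⟩, k, hk⟩ := hg
  have h1 : g 1 0 = X ^ 2 * ((X - 1) * k) := by rw [hk]; ring
  have h2 := lowEntry_eq h1
  refine ⟨by rw [h2, h1], by simp [h2], u, hu, ?_⟩
  rw [← hdet, Matrix.det_fin_two, relSnd, relFst, h2, h1]
  ring

theorem lowEntry_neg (g : Matrix (Fin 2) (Fin 2) (ZMod 3)[X]) : lowEntry (-g) = -lowEntry g := by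
  ext n
  simp [lowEntry, coeff_divX]

theorem rowData_neg (g : Matrix (Fin 2) (Fin 2) (ZMod 3)[X]) : rowData (-g) = -rowData g := by
  simp only [rowData, betaFst, betaSnd, relFst, relSnd, lowEntry_neg, Matrix.neg_apply,
    Prod.neg_mk, Prod.mk.injEq, true_and]
  constructor <;> ring

theorem relFst_eq (g : Matrix (Fin 2) (Fin 2) (ZMod 3)[X]) :
    relFst g = (rowData g).2.2.2 * listPoly beta21 - (rowData g).2.2.1 * listPoly beta22 := by
  simp only [rowData, betaFst, betaSnd]
  linear_combination (relFst g) * det_beta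

theorem relSnd_eq (g : Matrix (Fin 2) (Fin 2) (ZMod 3)[X]) :
    relSnd g = (rowData g).2.2.1 * listPoly beta12 - (rowData g).2.2.2 * listPoly beta11 := by
  simp only [rowData, betaFst, betaSnd]
  linear_combination (relSnd g) * det_beta

theorem rowData_injOn : Set.InjOn rowData Gamma0TTT := by
  intro g hg h hh hgh
  have e1 := relFst_eq g
  have e2 := relSnd_eq g
  rw [hgh, ← relFst_eq h] at e1
  rw [hgh, ← relSnd_eq h] at e2
  have e3 : lowEntry g = lowEntry h := congrArg Prod.fst hgh
  have e4 : g 1 1 = h 1 1 := congrArg (fun x => x.2.1) hgh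
  have e5 : g 1 0 = h 1 0 := by
    rw [(exists_of_mem_Gamma0TTT hg).1, (exists_of_mem_Gamma0TTT hh).1, e3]
  have e6 : g 0 0 = h 0 0 := by
    rw [relFst, relFst, e3] at e1
    linear_combination -e1
  have e7 : g 0 1 = h 0 1 := by
    rw [relSnd, relSnd, e4] at e2
    exact mul_left_cancel₀ (pow_ne_zero 2 X_ne_zero) (sub_right_injective e2)
  exact Matrix.ext fun i j => by fin_cases i <;> fin_cases j <;> assumption

/-- The exponent of the first denominator in the estimate of a factor. -/
noncomputable def fstDegree (g : Matrix (Fin 2) (Fin 2) (ZMod 3)[X]) : ℕ :=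
  max (rowData g).1.natDegree (rowData g).2.1.natDegree

/-- The exponent of the second denominator in the estimate of a factor. -/
noncomputable def sndDegree (g : Matrix (Fin 2) (Fin 2) (ZMod 3)[X]) : ℕ :=
  max (rowData g).2.2.1.natDegree (rowData g).2.2.2.natDegree

theorem finite_natDegree_le (N : ℕ) : {p : (ZMod 3)[X] | p.natDegree ≤ N}.Finite := by
  refine ((List.finite_length_eq (ZMod 3) (N + 1)).image listPoly).subset fun p hp => ?_
  exact ⟨_, by simp, (eq_listPoly_of_natDegree_le hp).symm⟩

theorem finite_degree_le (N : ℕ) :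
    {g : Gamma0TTT | fstDegree g.val ≤ N ∧ sndDegree g.val ≤ N}.Finite := by
  have hf := finite_natDegree_le N
  refine Set.Finite.of_finite_image (f := fun g : Gamma0TTT => rowData g.val)
    ((hf.prod (hf.prod (hf.prod hf))).subset ?_) ?_
  · rintro _ ⟨g, ⟨h1, h2⟩, rfl⟩
    simp only [fstDegree, sndDegree, max_le_iff] at h1 h2
    exact ⟨h1.1, h1.2, h2.1, h2.2⟩
  · intro g _ h _ hgh
    exact Subtype.ext (rowData_injOn g.2 h.2 hgh)

end RowData

section Factor

variable {𝕂 : Type*} [NormedField 𝕂] [Algebra (LaurentSeries (ZMod 3)) 𝕂]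

theorem linForm_ne_zero (hna : ∀ x y : 𝕂, ‖x + y‖ ≤ max ‖x‖ ‖y‖)
    (hext : ∀ x : LaurentSeries (ZMod 3), ‖algebraMap (LaurentSeries (ZMod 3)) 𝕂 x‖ = absK3 x)
    {ρ : 𝕂} (hρ : ρ ^ 2 + 1 = 0) {P Q : (ZMod 3)[X]} (h : P ≠ 0 ∨ Q ≠ 0) : linForm ρ P Q ≠ 0 := by
  rw [← norm_pos_iff, norm_linForm_max hna hext hρ h]
  positivity

theorem beta_det_eq {A D P Q : (ZMod 3)[X]} :
    betaFst A D * betaSnd P Q - betaSnd A D * betaFst P Q = D * P - A * Q := by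
  simp only [betaFst, betaSnd]
  linear_combination (A * Q - D * P) * det_beta

theorem row_ne_zero {A D P Q : (ZMod 3)[X]} {u : ZMod 3} (hu : u ≠ 0)
    (h : D * P - A * Q = Polynomial.C u) : P ≠ 0 ∨ Q ≠ 0 := by
  by_contra hcon
  push Not at hcon
  rw [hcon.1, hcon.2, mul_zero, mul_zero, sub_zero] at h
  exact hu (C_eq_zero.1 h.symm)

theorem linForm_beta (ρ : 𝕂) (P Q : (ZMod 3)[X]) :
    linForm ρ (betaFst P Q) (betaSnd P Q) =
      polyEmb3 𝕂 P * linForm ρ (listPoly beta11) (listPoly beta12) +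
        polyEmb3 𝕂 Q * linForm ρ (listPoly beta21) (listPoly beta22) := by
  simp only [linForm, betaFst, betaSnd, map_add, map_mul]
  ring

theorem sub_act3_eq {t w : 𝕂} (ht : polyEmb3 𝕂 X ^ 2 * t = 1)
    {g : Matrix (Fin 2) (Fin 2) (ZMod 3)[X]} (hP : g 1 0 = X ^ 2 * lowEntry g)
    (hw : linForm w (lowEntry g) (g 1 1) ≠ 0) :
    t - act3 g (t * w) = t * linForm w (relFst g) (relSnd g) / linForm w (lowEntry g) (g 1 1) := by
  have h1 : polyEmb3 𝕂 (g 1 0) * (t * w) + polyEmb3 𝕂 (g 1 1)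
      = linForm w (lowEntry g) (g 1 1) := by
    rw [hP, map_mul, map_pow, linForm]
    linear_combination (polyEmb3 𝕂 (lowEntry g) * w) * ht
  rw [act3, h1, eq_div_iff hw, sub_mul, div_mul_cancel₀ _ hw]
  simp only [linForm, relFst, relSnd, map_sub, map_mul, map_pow]
  linear_combination polyEmb3 𝕂 (g 0 1) * ht

theorem act3_alpha3 {t ρ : 𝕂} (ht : polyEmb3 𝕂 X ^ 2 * t = 1) :
    act3 alpha3 (t * ρ) = t * (linForm ρ (listPoly beta11) (listPoly beta12) /
      linForm ρ (listPoly beta21) (listPoly beta22)) := by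
  rw [act3, ← mul_div_assoc, alpha3_zero_zero, alpha3_one_zero, alpha3_one_one,
    ← X_sq_mul_alpha3_zero_one]
  simp only [linForm, map_mul, map_pow]
  congr 1
  · linear_combination -(polyEmb3 𝕂 (alpha3 0 1)) * ht
  · linear_combination (polyEmb3 𝕂 (listPoly beta21) * ρ) * ht

/-- The factor of the product indexed by `g`, in terms of linear forms. -/
theorem factor_eq (hna : ∀ x y : 𝕂, ‖x + y‖ ≤ max ‖x‖ ‖y‖)
    (hext : ∀ x : LaurentSeries (ZMod 3), ‖algebraMap (LaurentSeries (ZMod 3)) 𝕂 x‖ = absK3 x)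
    {ρ ω s : 𝕂} (hρ : ρ ^ 2 + 1 = 0) (hω : ω = (polyEmb3 𝕂 X)⁻¹ ^ 2 * ρ)
    (hs : s = (polyEmb3 𝕂 X)⁻¹ ^ 2) {g : Matrix (Fin 2) (Fin 2) (ZMod 3)[X]}
    (hg : g ∈ Gamma0TTT) :
    (s - act3 g ω) / (s - act3 g (act3 alpha3 ω)) =
      (linForm ρ (relFst g) (relSnd g) *
        linForm ρ (betaFst (lowEntry g) (g 1 1)) (betaSnd (lowEntry g) (g 1 1))) /
      (linForm ρ (rowData g).1 (rowData g).2.1 *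
        linForm ρ (rowData g).2.2.1 (rowData g).2.2.2) := by
  obtain ⟨hP, -, u, hu, hdet⟩ := exists_of_mem_Gamma0TTT hg
  have hT : polyEmb3 𝕂 X ≠ 0 := by
    rw [← norm_pos_iff, norm_polyEmb3_X hext]; norm_num
  have h1 := linForm_ne_zero hna hext hρ (row_ne_zero hu hdet)
  have hdet' := beta_det_eq.trans hdet
  have h2 := linForm_ne_zero hna hext hρ (row_ne_zero
    (P := betaSnd (lowEntry g) (g 1 1)) (Q := betaFst (lowEntry g) (g 1 1)) hu hdet').symm
  have h3 := linForm_ne_zero hna hext hρ (row_ne_zero (A := betaSnd (lowEntry g) (g 1 1))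
    (D := betaFst (lowEntry g) (g 1 1)) (P := -betaSnd (relFst g) (relSnd g))
    (Q := -betaFst (relFst g) (relSnd g)) hu (by rw [← hdet']; ring)).symm
  have h4 : linForm ρ (listPoly beta21) (listPoly beta22) ≠ 0 :=
    linForm_ne_zero hna hext hρ (Or.inl (by rw [Ne, listPoly_eq_zero_iff]; decide))
  have ht : polyEmb3 𝕂 X ^ 2 * (polyEmb3 𝕂 X)⁻¹ ^ 2 = 1 := by field_simp
  set t := (polyEmb3 𝕂 X)⁻¹ ^ 2
  have ht0 : t ≠ 0 := right_ne_zero_of_mul_eq_one ht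
  rw [linForm_beta] at h2
  have h3' : linForm ρ (betaFst (relFst g) (relSnd g)) (betaSnd (relFst g) (relSnd g)) ≠ 0 := by
    intro h
    apply h3
    rw [← neg_zero, ← h]
    simp only [linForm, map_neg]
    ring
  rw [linForm_beta] at h3'
  have h5 : ∀ P Q : (ZMod 3)[X],
      linForm (linForm ρ (listPoly beta11) (listPoly beta12) /
        linForm ρ (listPoly beta21) (listPoly beta22)) P Q =
      (polyEmb3 𝕂 P * linForm ρ (listPoly beta11) (listPoly beta12) +
        polyEmb3 𝕂 Q * linForm ρ (listPoly beta21) (listPoly beta22)) /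
        linForm ρ (listPoly beta21) (listPoly beta22) := by
    intro P Q
    rw [linForm]
    field_simp
  rw [hω, hs, act3_alpha3 ht, sub_act3_eq ht hP h1, sub_act3_eq ht hP, h5, h5, linForm_beta]
  · simp only [rowData]
    rw [linForm_beta]
    field_simp
  · rw [h5]
    exact div_ne_zero h2 h4

theorem norm_factor_sub_one (hna : ∀ x y : 𝕂, ‖x + y‖ ≤ max ‖x‖ ‖y‖)
    (hext : ∀ x : LaurentSeries (ZMod 3), ‖algebraMap (LaurentSeries (ZMod 3)) 𝕂 x‖ = absK3 x)
    {ρ ω s : 𝕂} (hρ : ρ ^ 2 + 1 = 0) (hω : ω = (polyEmb3 𝕂 X)⁻¹ ^ 2 * ρ)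
    (hs : s = (polyEmb3 𝕂 X)⁻¹ ^ 2) {g : Matrix (Fin 2) (Fin 2) (ZMod 3)[X]}
    (hg : g ∈ Gamma0TTT) :
    ‖(s - act3 g ω) / (s - act3 g (act3 alpha3 ω)) - 1‖ =
      3 ^ 3 / 3 ^ (fstDegree g + sndDegree g) := by
  obtain ⟨hP, -, u, hu, hdet⟩ := exists_of_mem_Gamma0TTT hg
  have h1 : (rowData g).1 ≠ 0 ∨ (rowData g).2.1 ≠ 0 := row_ne_zero hu hdet
  have hdet' := beta_det_eq.trans hdet
  have h2 := (row_ne_zero (A := betaSnd (lowEntry g) (g 1 1))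
    (D := betaFst (lowEntry g) (g 1 1)) (P := -betaSnd (relFst g) (relSnd g))
    (Q := -betaFst (relFst g) (relSnd g)) hu (by rw [← hdet']; ring)).symm
  rw [neg_ne_zero, neg_ne_zero] at h2
  change (rowData g).2.2.1 ≠ 0 ∨ (rowData g).2.2.2 ≠ 0 at h2
  have hden : linForm ρ (rowData g).1 (rowData g).2.1 *
      linForm ρ (rowData g).2.2.1 (rowData g).2.2.2 ≠ 0 :=
    mul_ne_zero (linForm_ne_zero hna hext hρ h1) (linForm_ne_zero hna hext hρ h2)
  have hnum : linForm ρ (relFst g) (relSnd g) *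
        linForm ρ (betaFst (lowEntry g) (g 1 1)) (betaSnd (lowEntry g) (g 1 1)) -
      linForm ρ (rowData g).1 (rowData g).2.1 * linForm ρ (rowData g).2.2.1 (rowData g).2.2.2 =
      -(polyEmb3 𝕂 (Polynomial.C u) *
        linForm ρ (listPoly (listSub beta22 beta11)) (listPoly (listNeg (listAdd beta21 beta12)))) := by
    rw [← hdet]
    simp only [rowData]
    rw [linForm_beta, linForm_beta, listPoly_sub, listPoly_neg, listPoly_add]
    simp only [linForm, map_sub, map_neg, map_add, map_mul]
    linear_combination (polyEmb3 𝕂 (listPoly beta21) * (polyEmb3 𝕂 (relFst g) *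
      polyEmb3 𝕂 (g 1 1) - polyEmb3 𝕂 (relSnd g) * polyEmb3 𝕂 (lowEntry g))) * hρ
  have hK : ‖linForm ρ (listPoly (listSub beta22 beta11))
      (listPoly (listNeg (listAdd beta21 beta12)))‖ = 3 ^ 3 := by
    refine norm_linForm hna hext hρ (natDegree_listPoly_le (by decide))
      (natDegree_listPoly_le (by decide)) (Or.inl ?_)
    rw [coeff_listPoly]
    decide
  rw [factor_eq hna hext hρ hω hs hg, div_sub_one hden, hnum, norm_div, norm_neg, norm_mul, norm_mul,
    norm_polyEmb3_C hu, hK, norm_linForm_max hna hext hρ h1, norm_linForm_max hna hext hρ h2,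
    one_mul, ← pow_add]
  rfl

end Factor

section Classification

/-- The rows `(P, Q)` and `(E, F)` of the factors which are not close to `1`, up to sign. -/
def rowTable : List (List (ZMod 3) × List (ZMod 3) × List (ZMod 3) × List (ZMod 3)) := [
  ([], [1], [2, 2, 2, 2], [1, 2, 1, 1]),
  ([], [1], [2, 2, 0, 0, 1], [1, 2, 2, 0, 2]),
  ([], [1], [2, 2, 1, 1, 2], [1, 2, 0, 2, 1]),
  ([], [1], [0, 0, 0, 1], [1, 2, 0, 2]),
  ([], [1], [0, 0, 1, 2, 1], [1, 2, 1, 1, 2]),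
  ([], [1], [0, 0, 2, 0, 2], [1, 2, 2, 0, 1]),
  ([0, 2, 2, 2], [1, 1, 2, 2, 1], [2], [1]),
  ([0, 1, 2], [2, 2, 0, 1], [1], [2]),
  ([0, 1, 0, 2], [2, 2, 2, 1, 1], [1], [2]),
  ([2, 2, 2], [2, 2, 2, 1], [2], [2]),
  ([2, 2, 2], [2, 2, 2, 1], [1], [2]),
  ([2, 2, 0, 2], [2, 2, 1, 1, 1], [1], [2]),
  ([1, 2], [2, 1, 1], [0, 1, 1], [2, 2, 2]),
  ([1, 1, 2, 2], [1, 1, 0, 2, 1], [2], [1])]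

/-- Whether all coefficients of a list vanish. -/
def listIsZero (l : List (ZMod 3)) : Bool := l.all fun a => decide (a = 0)

/-- Whether the given rows occur in `rowTable`, up to sign. -/
def isRow (p q e f : List (ZMod 3)) : Bool :=
  rowTable.any fun t =>
    (listIsZero (listSub p t.1) && listIsZero (listSub q t.2.1) &&
      listIsZero (listSub e t.2.2.1) && listIsZero (listSub f t.2.2.2)) ||
    (listIsZero (listAdd p t.1) && listIsZero (listAdd q t.2.1) &&
      listIsZero (listAdd e t.2.2.1) && listIsZero (listAdd f t.2.2.2))

/-- The four polynomials with the given coefficients. -/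
noncomputable def listRow
    (t : List (ZMod 3) × List (ZMod 3) × List (ZMod 3) × List (ZMod 3)) :
    (ZMod 3)[X] × (ZMod 3)[X] × (ZMod 3)[X] × (ZMod 3)[X] :=
  (listPoly t.1, listPoly t.2.1, listPoly t.2.2.1, listPoly t.2.2.2)

theorem listIsZero_iff (l : List (ZMod 3)) : listIsZero l = true ↔ listPoly l = 0 := by
  simp [listIsZero, listPoly_eq_zero_iff]

theorem exists_of_isRow {p q e f : List (ZMod 3)} (h : isRow p q e f = true) :
    ∃ t ∈ rowTable, listRow (p, q, e, f) = listRow t ∨ listRow (p, q, e, f) = -listRow t := by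
  obtain ⟨t, ht, h⟩ := List.any_eq_true.1 h
  refine ⟨t, ht, ?_⟩
  simpa [listIsZero_iff, listPoly_sub, listPoly_add, sub_eq_zero, add_eq_zero_iff_eq_neg, listRow,
    and_assoc] using h

/-- Coefficients of the determinant of a matrix, in terms of its rows. -/
def detList (p q e f : List (ZMod 3)) : List (ZMod 3) :=
  listSub (listMul (listSub (listMul e beta12) (listMul f beta11)) p)
    (listMul (listSub (listMul f beta21) (listMul e beta22)) q)

/-- Coefficients of the difference of bottom right entries, in terms of the rows. -/
def diffList (q e f : List (ZMod 3)) : List (ZMod 3) :=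
  listSub q (listSub (listMul e beta12) (listMul f beta11))

theorem eval_one_listPoly (l : List (ZMod 3)) : (listPoly l).eval 1 = l.sum := by
  induction l with
  | nil => simp [listPoly]
  | cons a l ih => simp [listPoly, ih]

theorem coeff_relations {g : Matrix (Fin 2) (Fin 2) (ZMod 3)[X]} (hg : g ∈ Gamma0TTT)
    {p q e f : List (ZMod 3)} (h : rowData g = listRow (p, q, e, f)) :
    p.sum = 0 ∧ (diffList q e f).getD 0 0 = 0 ∧ (diffList q e f).getD 1 0 = 0 ∧
      ∃ u : ZMod 3, u ≠ 0 ∧ ∀ k, (detList p q e f).getD k 0 = if k = 0 then u else 0 := by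
  obtain ⟨-, hev, u, hu, hdet⟩ := exists_of_mem_Gamma0TTT hg
  have h1 := relFst_eq g
  have h2 := relSnd_eq g
  have h3 : lowEntry g = listPoly p := congrArg Prod.fst h
  have h4 : g 1 1 = listPoly q := congrArg (fun x => x.2.1) h
  rw [h] at h1 h2
  have h5 : listPoly (diffList q e f) = X ^ 2 * g 0 1 := by
    rw [diffList, listPoly_sub, listPoly_sub, listPoly_mul, listPoly_mul, ← h4]
    simp only [listRow] at h2
    rw [← h2, relSnd]
    ring
  refine ⟨by rw [← eval_one_listPoly, ← h3, hev], ?_, ?_, u, hu, fun k => ?_⟩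
  · rw [← coeff_listPoly, h5, coeff_X_pow_mul']; simp
  · rw [← coeff_listPoly, h5, coeff_X_pow_mul']; simp
  · rw [← coeff_listPoly, ← coeff_C, ← hdet, h1, h2, h3, h4]
    simp only [detList, listRow, listPoly_sub, listPoly_mul]

set_option synthInstance.maxHeartbeats 400000 in
set_option synthInstance.maxSize 1000 in
theorem isRow_zero_four :
    ∀ p0 : ZMod 3, p0 = 0 →
    ∀ e4 f4 : ZMod 3, 2 * e4 * p0 - f4 * p0 = 0 →
    ∀ f0 q0 : ZMod 3, -(2 * f0) - q0 = 0 →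
    ∀ e0 : ZMod 3, e0 * q0 - 2 * f0 * p0 - f0 * q0 ≠ 0 →
    ∀ f1 : ZMod 3, -(2 * f0) - 2 * f1 = 0 →
    ∀ e1 : ZMod 3, 2 * e0 * q0 + e1 * q0 - 2 * f0 * p0 - 2 * f1 * p0 - f0 * q0 - f1 * q0 = 0 →
    ∀ e2 f2 : ZMod 3, e0 * p0 + 2 * e0 * q0 + 2 * e1 * q0 + e2 * q0 - 2 * f0 * p0 - 2 * f1 * p0 -
      2 * f2 * p0 - f0 * q0 - f1 * q0 - f2 * q0 = 0 →
    ∀ e3 f3 : ZMod 3, 2 * e0 * p0 + e1 * p0 + 2 * e1 * q0 + 2 * e2 * q0 + e3 * q0 - f0 * p0 - 2 *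
      f1 * p0 - 2 * f2 * p0 - 2 * f3 * p0 - f1 * q0 - f2 * q0 - f3 * q0 = 0 →
    2 * e1 * p0 + e2 * p0 + 2 * e2 * q0 + 2 * e3 * q0 + e4 * q0 - f1 * p0 - 2 * f2 * p0 - 2 * f3 *
      p0 - 2 * f4 * p0 - f2 * q0 - f3 * q0 - f4 * q0 = 0 →
    2 * e2 * p0 + e3 * p0 + 2 * e3 * q0 + 2 * e4 * q0 - f2 * p0 - 2 * f3 * p0 - 2 * f4 * p0 - f3 *
      q0 - f4 * q0 = 0 →
    2 * e3 * p0 + e4 * p0 + 2 * e4 * q0 - f3 * p0 - 2 * f4 * p0 - f4 * q0 = 0 →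
    isRow [p0] [q0] [e0, e1, e2, e3, e4] [f0, f1, f2, f3, f4] = true := by
  decide +kernel

set_option synthInstance.maxHeartbeats 400000 in
set_option synthInstance.maxSize 1000 in
theorem isRow_one_three :
    ∀ p0 p1 : ZMod 3, p0 + p1 = 0 →
    ∀ e3 f3 : ZMod 3, 2 * e3 * p1 - f3 * p1 = 0 →
    ∀ f0 q0 : ZMod 3, -(2 * f0) - q0 = 0 →
    ∀ e0 : ZMod 3, e0 * q0 - 2 * f0 * p0 - f0 * q0 ≠ 0 →
    ∀ f1 q1 : ZMod 3, -(2 * f0) - 2 * f1 - q1 = 0 →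
    ∀ e1 : ZMod 3, 2 * e0 * q0 + e0 * q1 + e1 * q0 - 2 * f0 * p0 - 2 * f0 * p1 - 2 * f1 * p0 - f0
      * q0 - f0 * q1 - f1 * q0 = 0 →
    ∀ e2 f2 : ZMod 3, e0 * p0 + 2 * e0 * q0 + 2 * e0 * q1 + 2 * e1 * q0 + e1 * q1 + e2 * q0 - 2 *
      f0 * p0 - 2 * f0 * p1 - 2 * f1 * p0 - 2 * f1 * p1 - 2 * f2 * p0 - f0 * q0 - f0 * q1 - f1 *
      q0 - f1 * q1 - f2 * q0 = 0 →
    2 * e0 * p0 + e0 * p1 + e1 * p0 + 2 * e0 * q1 + 2 * e1 * q0 + 2 * e1 * q1 + 2 * e2 * q0 + e2 *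
      q1 + e3 * q0 - f0 * p0 - 2 * f0 * p1 - 2 * f1 * p0 - 2 * f1 * p1 - 2 * f2 * p0 - 2 * f2 * p1
      - 2 * f3 * p0 - f0 * q1 - f1 * q0 - f1 * q1 - f2 * q0 - f2 * q1 - f3 * q0 = 0 →
    2 * e0 * p1 + 2 * e1 * p0 + e1 * p1 + e2 * p0 + 2 * e1 * q1 + 2 * e2 * q0 + 2 * e2 * q1 + 2 *
      e3 * q0 + e3 * q1 - f0 * p1 - f1 * p0 - 2 * f1 * p1 - 2 * f2 * p0 - 2 * f2 * p1 - 2 * f3 *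
      p0 - 2 * f3 * p1 - f1 * q1 - f2 * q0 - f2 * q1 - f3 * q0 - f3 * q1 = 0 →
    2 * e1 * p1 + 2 * e2 * p0 + e2 * p1 + e3 * p0 + 2 * e2 * q1 + 2 * e3 * q0 + 2 * e3 * q1 - f1 *
      p1 - f2 * p0 - 2 * f2 * p1 - 2 * f3 * p0 - 2 * f3 * p1 - f2 * q1 - f3 * q0 - f3 * q1 = 0 →
    2 * e2 * p1 + 2 * e3 * p0 + e3 * p1 + 2 * e3 * q1 - f2 * p1 - f3 * p0 - 2 * f3 * p1 - f3 * q1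
      = 0 →
    isRow [p0, p1] [q0, q1] [e0, e1, e2, e3] [f0, f1, f2, f3] = true := by
  decide +kernel

set_option synthInstance.maxHeartbeats 400000 in
set_option synthInstance.maxSize 1000 in
theorem isRow_two_two :
    ∀ f0 q0 : ZMod 3, -(2 * f0) - q0 = 0 →
    ∀ e0 p0 : ZMod 3, e0 * q0 - 2 * f0 * p0 - f0 * q0 ≠ 0 →
    ∀ p1 p2 : ZMod 3, p0 + p1 + p2 = 0 →
    ∀ e2 f2 : ZMod 3, 2 * e2 * p2 - f2 * p2 = 0 →
    ∀ f1 q1 : ZMod 3, -(2 * f0) - 2 * f1 - q1 = 0 →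
    ∀ e1 : ZMod 3, 2 * e0 * q0 + e0 * q1 + e1 * q0 - 2 * f0 * p0 - 2 * f0 * p1 - 2 * f1 * p0 - f0
      * q0 - f0 * q1 - f1 * q0 = 0 →
    ∀ q2 : ZMod 3, e0 * p0 + 2 * e0 * q0 + 2 * e0 * q1 + e0 * q2 + 2 * e1 * q0 + e1 * q1 + e2 * q0
      - 2 * f0 * p0 - 2 * f0 * p1 - 2 * f0 * p2 - 2 * f1 * p0 - 2 * f1 * p1 - 2 * f2 * p0 - f0 *
      q0 - f0 * q1 - f0 * q2 - f1 * q0 - f1 * q1 - f2 * q0 = 0 →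
    2 * e0 * p0 + e0 * p1 + e1 * p0 + 2 * e0 * q1 + 2 * e0 * q2 + 2 * e1 * q0 + 2 * e1 * q1 + e1 *
      q2 + 2 * e2 * q0 + e2 * q1 - f0 * p0 - 2 * f0 * p1 - 2 * f0 * p2 - 2 * f1 * p0 - 2 * f1 * p1
      - 2 * f1 * p2 - 2 * f2 * p0 - 2 * f2 * p1 - f0 * q1 - f0 * q2 - f1 * q0 - f1 * q1 - f1 * q2
      - f2 * q0 - f2 * q1 = 0 →
    2 * e0 * p1 + e0 * p2 + 2 * e1 * p0 + e1 * p1 + e2 * p0 + 2 * e0 * q2 + 2 * e1 * q1 + 2 * e1 *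
      q2 + 2 * e2 * q0 + 2 * e2 * q1 + e2 * q2 - f0 * p1 - 2 * f0 * p2 - f1 * p0 - 2 * f1 * p1 - 2
      * f1 * p2 - 2 * f2 * p0 - 2 * f2 * p1 - 2 * f2 * p2 - f0 * q2 - f1 * q1 - f1 * q2 - f2 * q0
      - f2 * q1 - f2 * q2 = 0 →
    2 * e0 * p2 + 2 * e1 * p1 + e1 * p2 + 2 * e2 * p0 + e2 * p1 + 2 * e1 * q2 + 2 * e2 * q1 + 2 *
      e2 * q2 - f0 * p2 - f1 * p1 - 2 * f1 * p2 - f2 * p0 - 2 * f2 * p1 - 2 * f2 * p2 - f1 * q2 -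
      f2 * q1 - f2 * q2 = 0 →
    2 * e1 * p2 + 2 * e2 * p1 + e2 * p2 + 2 * e2 * q2 - f1 * p2 - f2 * p1 - 2 * f2 * p2 - f2 * q2
      = 0 →
    isRow [p0, p1, p2] [q0, q1, q2] [e0, e1, e2] [f0, f1, f2] = true := by
  decide +kernel

set_option synthInstance.maxHeartbeats 400000 in
set_option synthInstance.maxSize 1000 in
theorem isRow_three_one :
    ∀ f0 q0 : ZMod 3, -(2 * f0) - q0 = 0 →
    ∀ e0 p0 : ZMod 3, e0 * q0 - 2 * f0 * p0 - f0 * q0 ≠ 0 →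
    ∀ f1 q1 : ZMod 3, -(2 * f0) - 2 * f1 - q1 = 0 →
    ∀ e1 p1 : ZMod 3, 2 * e0 * q0 + e0 * q1 + e1 * q0 - 2 * f0 * p0 - 2 * f0 * p1 - 2 * f1 * p0 -
      f0 * q0 - f0 * q1 - f1 * q0 = 0 →
    ∀ p3 : ZMod 3, 2 * e1 * p3 - f1 * p3 = 0 →
    ∀ p2 : ZMod 3, p0 + p1 + p2 + p3 = 0 →
    ∀ q2 : ZMod 3, e0 * p0 + 2 * e0 * q0 + 2 * e0 * q1 + e0 * q2 + 2 * e1 * q0 + e1 * q1 - 2 * f0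
      * p0 - 2 * f0 * p1 - 2 * f0 * p2 - 2 * f1 * p0 - 2 * f1 * p1 - f0 * q0 - f0 * q1 - f0 * q2 -
      f1 * q0 - f1 * q1 = 0 →
    ∀ q3 : ZMod 3, 2 * e0 * p0 + e0 * p1 + e1 * p0 + 2 * e0 * q1 + 2 * e0 * q2 + e0 * q3 + 2 * e1
      * q0 + 2 * e1 * q1 + e1 * q2 - f0 * p0 - 2 * f0 * p1 - 2 * f0 * p2 - 2 * f0 * p3 - 2 * f1 *
      p0 - 2 * f1 * p1 - 2 * f1 * p2 - f0 * q1 - f0 * q2 - f0 * q3 - f1 * q0 - f1 * q1 - f1 * q2 =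
      0 →
    2 * e0 * p1 + e0 * p2 + 2 * e1 * p0 + e1 * p1 + 2 * e0 * q2 + 2 * e0 * q3 + 2 * e1 * q1 + 2 *
      e1 * q2 + e1 * q3 - f0 * p1 - 2 * f0 * p2 - 2 * f0 * p3 - f1 * p0 - 2 * f1 * p1 - 2 * f1 *
      p2 - 2 * f1 * p3 - f0 * q2 - f0 * q3 - f1 * q1 - f1 * q2 - f1 * q3 = 0 →
    2 * e0 * p2 + e0 * p3 + 2 * e1 * p1 + e1 * p2 + 2 * e0 * q3 + 2 * e1 * q2 + 2 * e1 * q3 - f0 *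
      p2 - 2 * f0 * p3 - f1 * p1 - 2 * f1 * p2 - 2 * f1 * p3 - f0 * q3 - f1 * q2 - f1 * q3 = 0 →
    2 * e0 * p3 + 2 * e1 * p2 + e1 * p3 + 2 * e1 * q3 - f0 * p3 - f1 * p2 - 2 * f1 * p3 - f1 * q3
      = 0 →
    isRow [p0, p1, p2, p3] [q0, q1, q2, q3] [e0, e1] [f0, f1] = true := by
  decide +kernel

set_option synthInstance.maxHeartbeats 400000 in
set_option synthInstance.maxSize 1000 in
theorem isRow_four_zero :
    ∀ f0 q0 : ZMod 3, -(2 * f0) - q0 = 0 →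
    ∀ q1 : ZMod 3, -(2 * f0) - q1 = 0 →
    ∀ e0 p0 : ZMod 3, e0 * q0 - 2 * f0 * p0 - f0 * q0 ≠ 0 →
    ∀ p1 : ZMod 3, 2 * e0 * q0 + e0 * q1 - 2 * f0 * p0 - 2 * f0 * p1 - f0 * q0 - f0 * q1 = 0 →
    ∀ p4 : ZMod 3, 2 * e0 * p4 - f0 * p4 = 0 →
    ∀ p2 q2 : ZMod 3, e0 * p0 + 2 * e0 * q0 + 2 * e0 * q1 + e0 * q2 - 2 * f0 * p0 - 2 * f0 * p1 -
      2 * f0 * p2 - f0 * q0 - f0 * q1 - f0 * q2 = 0 →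
    ∀ p3 : ZMod 3, p0 + p1 + p2 + p3 + p4 = 0 →
    ∀ q3 : ZMod 3, 2 * e0 * p0 + e0 * p1 + 2 * e0 * q1 + 2 * e0 * q2 + e0 * q3 - f0 * p0 - 2 * f0
      * p1 - 2 * f0 * p2 - 2 * f0 * p3 - f0 * q1 - f0 * q2 - f0 * q3 = 0 →
    ∀ q4 : ZMod 3, 2 * e0 * p1 + e0 * p2 + 2 * e0 * q2 + 2 * e0 * q3 + e0 * q4 - f0 * p1 - 2 * f0
      * p2 - 2 * f0 * p3 - 2 * f0 * p4 - f0 * q2 - f0 * q3 - f0 * q4 = 0 →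
    2 * e0 * p2 + e0 * p3 + 2 * e0 * q3 + 2 * e0 * q4 - f0 * p2 - 2 * f0 * p3 - 2 * f0 * p4 - f0 *
      q3 - f0 * q4 = 0 →
    2 * e0 * p3 + e0 * p4 + 2 * e0 * q4 - f0 * p3 - 2 * f0 * p4 - f0 * q4 = 0 →
    isRow [p0, p1, p2, p3, p4] [q0, q1, q2, q3, q4] [e0] [f0] = true := by
  decide +kernel

theorem exists_row_of_degree_le {g : Matrix (Fin 2) (Fin 2) (ZMod 3)[X]} (hg : g ∈ Gamma0TTT)
    (h : fstDegree g + sndDegree g ≤ 4) :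
    ∃ t ∈ rowTable, rowData g = listRow t ∨ rowData g = -listRow t := by
  obtain ⟨m, n, hmn, hm, hn⟩ : ∃ m n, m + n = 4 ∧ fstDegree g ≤ m ∧ sndDegree g ≤ n :=
    ⟨fstDegree g, 4 - fstDegree g, by omega, le_rfl, by omega⟩
  rw [fstDegree, max_le_iff] at hm
  rw [sndDegree, max_le_iff] at hn
  obtain ⟨p, hp⟩ : ∃ p : ℕ → ZMod 3, (rowData g).1 = listPoly ((List.range (m + 1)).map p) :=
    ⟨_, eq_listPoly_of_natDegree_le hm.1⟩
  obtain ⟨q, hq⟩ : ∃ q : ℕ → ZMod 3, (rowData g).2.1 = listPoly ((List.range (m + 1)).map q) :=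
    ⟨_, eq_listPoly_of_natDegree_le hm.2⟩
  obtain ⟨e, he⟩ : ∃ e : ℕ → ZMod 3, (rowData g).2.2.1 = listPoly ((List.range (n + 1)).map e) :=
    ⟨_, eq_listPoly_of_natDegree_le hn.1⟩
  obtain ⟨f, hf⟩ : ∃ f : ℕ → ZMod 3, (rowData g).2.2.2 = listPoly ((List.range (n + 1)).map f) :=
    ⟨_, eq_listPoly_of_natDegree_le hn.2⟩
  have hrow : rowData g = listRow ((List.range (m + 1)).map p, (List.range (m + 1)).map q,
      (List.range (n + 1)).map e, (List.range (n + 1)).map f) :=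
    Prod.ext hp (Prod.ext hq (Prod.ext he hf))
  obtain ⟨hS, hD0, hD1, u, hu, hK⟩ := coeff_relations hg hrow
  rw [hrow]
  apply exists_of_isRow
  obtain rfl : n = 4 - m := by omega
  have hm4 : m ≤ 4 := by omega
  have hK0 := (hK 0).trans (if_pos rfl)
  have hK1 := (hK 1).trans (if_neg one_ne_zero)
  have hK2 := (hK 2).trans (if_neg two_ne_zero)
  have hK3 := (hK 3).trans (if_neg three_ne_zero)
  have hK4 := (hK 4).trans (if_neg four_ne_zero)
  have hK5 := (hK 5).trans (if_neg (Nat.succ_ne_zero 4))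
  have hK6 := (hK 6).trans (if_neg (Nat.succ_ne_zero 5))
  have hK7 := (hK 7).trans (if_neg (Nat.succ_ne_zero 6))
  clear hK hrow hp hq he hf hm hn hmn
  have h1 (r : ℕ → ZMod 3) : (List.range 1).map r = [r 0] := rfl
  have h2 (r : ℕ → ZMod 3) : (List.range 2).map r = [r 0, r 1] := rfl
  have h3 (r : ℕ → ZMod 3) : (List.range 3).map r = [r 0, r 1, r 2] := rfl
  have h4 (r : ℕ → ZMod 3) : (List.range 4).map r = [r 0, r 1, r 2, r 3] := rfl
  have h5 (r : ℕ → ZMod 3) : (List.range 5).map r = [r 0, r 1, r 2, r 3, r 4] := rfl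
  interval_cases m <;>
  simp only [Nat.reduceAdd, Nat.reduceSub, h1, h2, h3, h4, h5, detList, diffList, listSub, listMul,
    listAdd, listNeg, listSmul, beta11, beta12, beta21, beta22, List.getD_cons_zero,
    List.getD_cons_succ, List.sum_cons, List.sum_nil] at hK0 hK1 hK2 hK3 hK4 hK5 hK6 hK7 hS hD0 hD1
  · exact isRow_zero_four (p 0) (by linear_combination hS) (e 4) (f 4) (by linear_combination hK7)
      (f 0) (q 0) (by linear_combination -hD0) (e 0) (fun h => hu (by linear_combination h - hK0))
      (f 1) (by linear_combination -hD1) (e 1) (by linear_combination hK1) (e 2) (f 2)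
      (by linear_combination hK2) (e 3) (f 3) (by linear_combination hK3)
      (by linear_combination hK4) (by linear_combination hK5) (by linear_combination hK6)
  · exact isRow_one_three (p 0) (p 1) (by linear_combination hS) (e 3) (f 3)
      (by linear_combination hK7) (f 0) (q 0) (by linear_combination -hD0) (e 0)
      (fun h => hu (by linear_combination h - hK0)) (f 1) (q 1) (by linear_combination -hD1) (e 1)
      (by linear_combination hK1) (e 2) (f 2) (by linear_combination hK2)
      (by linear_combination hK3) (by linear_combination hK4) (by linear_combination hK5)
      (by linear_combination hK6)
  · exact isRow_two_two (f 0) (q 0) (by linear_combination -hD0) (e 0) (p 0)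
      (fun h => hu (by linear_combination h - hK0)) (p 1) (p 2) (by linear_combination hS) (e 2)
      (f 2) (by linear_combination hK7) (f 1) (q 1) (by linear_combination -hD1) (e 1)
      (by linear_combination hK1) (q 2) (by linear_combination hK2) (by linear_combination hK3)
      (by linear_combination hK4) (by linear_combination hK5) (by linear_combination hK6)
  · exact isRow_three_one (f 0) (q 0) (by linear_combination -hD0) (e 0) (p 0)
      (fun h => hu (by linear_combination h - hK0)) (f 1) (q 1) (by linear_combination -hD1) (e 1)
      (p 1) (by linear_combination hK1) (p 3) (by linear_combination hK7) (p 2)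
      (by linear_combination hS) (q 2) (by linear_combination hK2) (q 3)
      (by linear_combination hK3) (by linear_combination hK4) (by linear_combination hK5)
      (by linear_combination hK6)
  · exact isRow_four_zero (f 0) (q 0) (by linear_combination -hD0) (q 1)
      (by linear_combination -hD1) (e 0) (p 0) (fun h => hu (by linear_combination h - hK0)) (p 1)
      (by linear_combination hK1) (p 4) (by linear_combination hK7) (p 2) (q 2)
      (by linear_combination hK2) (p 3) (by linear_combination hS) (q 3)
      (by linear_combination hK3) (q 4) (by linear_combination hK4) (by linear_combination hK5)
      (by linear_combination hK6)

end Classification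

section Table

/-- The first relative entry determined by the rows. -/
def fstList (t : List (ZMod 3) × List (ZMod 3) × List (ZMod 3) × List (ZMod 3)) : List (ZMod 3) :=
  listSub (listMul t.2.2.2 beta21) (listMul t.2.2.1 beta22)

/-- The second relative entry determined by the rows. -/
def sndList (t : List (ZMod 3) × List (ZMod 3) × List (ZMod 3) × List (ZMod 3)) : List (ZMod 3) :=
  listSub (listMul t.2.2.1 beta12) (listMul t.2.2.2 beta11)

/-- The top right entry determined by the rows. -/
def topRightList (t : List (ZMod 3) × List (ZMod 3) × List (ZMod 3) × List (ZMod 3)) :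
    List (ZMod 3) :=
  (listSub t.2.1 (sndList t)).drop 2

/-- The matrix with the given rows. -/
noncomputable def rowMatrix
    (t : List (ZMod 3) × List (ZMod 3) × List (ZMod 3) × List (ZMod 3)) :
    Matrix (Fin 2) (Fin 2) (ZMod 3)[X] :=
  !![listPoly t.1 - listPoly (fstList t), listPoly (topRightList t);
    X ^ 2 * listPoly t.1, listPoly t.2.1]

/-- Whether the given rows come from a matrix in `Gamma0TTT`. -/
def isAdmissible (t : List (ZMod 3) × List (ZMod 3) × List (ZMod 3) × List (ZMod 3)) : Bool :=
  decide (t.1.sum = 0) &&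
  listIsZero (listSub (listSub t.2.1 (sndList t)) (0 :: 0 :: topRightList t)) &&
  listIsZero (listSub
    (listAdd (listMul (fstList t) beta11) (listMul (sndList t) beta21)) t.2.2.1) &&
  listIsZero (listSub
    (listAdd (listMul (fstList t) beta12) (listMul (sndList t) beta22)) t.2.2.2) &&
  decide ((detList t.1 t.2.1 t.2.2.1 t.2.2.2).headD 0 ≠ 0) &&
  listIsZero (detList t.1 t.2.1 t.2.2.1 t.2.2.2).tail

theorem isAdmissible_of_mem_rowTable : ∀ t ∈ rowTable, isAdmissible t = true := by
  decide +kernel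

theorem listPoly_eq_C {l : List (ZMod 3)} (h : listIsZero l.tail = true) :
    listPoly l = Polynomial.C (l.headD 0) := by
  cases l with
  | nil => simp [listPoly]
  | cons a l => rw [listPoly, (listIsZero_iff l).1 h]; simp

theorem rowMatrix_spec {t : List (ZMod 3) × List (ZMod 3) × List (ZMod 3) × List (ZMod 3)}
    (ht : isAdmissible t = true) : rowMatrix t ∈ Gamma0TTT ∧ rowData (rowMatrix t) = listRow t := by
  simp only [isAdmissible, Bool.and_eq_true, decide_eq_true_eq] at ht
  obtain ⟨⟨⟨⟨⟨h1, h2⟩, h3⟩, h4⟩, h5⟩, h6⟩ := ht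
  rw [listIsZero_iff] at h2 h3 h4
  simp only [listPoly_sub, listPoly_add, listPoly_mul, listPoly, map_zero, zero_add] at h2 h3 h4
  have hlow : lowEntry (rowMatrix t) = listPoly t.1 := lowEntry_eq (by simp [rowMatrix])
  have hfst : relFst (rowMatrix t) = listPoly (fstList t) := by
    rw [relFst, hlow]; simp [rowMatrix]
  have hsnd : relSnd (rowMatrix t) = listPoly (sndList t) := by
    simp only [relSnd, rowMatrix, of_apply, cons_val', cons_val_zero, cons_val_one]
    linear_combination h2
  refine ⟨⟨⟨_, h5, ?_⟩, ?_⟩, ?_⟩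
  · rw [← listPoly_eq_C h6, det_fin_two]
    simp only [rowMatrix, of_apply, cons_val', cons_val_zero, cons_val_one, detList, listPoly_sub,
      listPoly_mul]
    simp only [fstList, sndList, listPoly_sub, listPoly_mul] at h2 ⊢
    linear_combination listPoly t.1 * h2
  · have h : X - Polynomial.C 1 ∣ listPoly t.1 := by
      rw [dvd_iff_isRoot, IsRoot, eval_one_listPoly, h1]
    have h' : (X : (ZMod 3)[X]) ^ 3 - X ^ 2 = X ^ 2 * (X - Polynomial.C 1) := by
      rw [map_one]; ring
    rw [h']
    simpa [rowMatrix] using mul_dvd_mul_left (X ^ 2) h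
  · rw [rowData, hlow, hfst, hsnd, listRow, betaFst, betaSnd]
    refine Prod.ext rfl (Prod.ext (by simp [rowMatrix]) (Prod.ext ?_ ?_))
    · linear_combination h3
    · linear_combination h4

/-- The elements of `Gamma0TTT` corresponding to the entries of `rowTable`. -/
noncomputable def rowElement (i : Fin rowTable.length) : Gamma0TTT :=
  ⟨rowMatrix (rowTable.get i),
    (rowMatrix_spec (isAdmissible_of_mem_rowTable _ (List.get_mem _ _))).1⟩

theorem rowData_rowElement (i : Fin rowTable.length) :
    rowData (rowElement i).val = listRow (rowTable.get i) :=
  (rowMatrix_spec (isAdmissible_of_mem_rowTable _ (List.get_mem _ _))).2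

theorem eq_of_listIsZero : ∀ i j : Fin rowTable.length,
    (listIsZero (listSub (rowTable.get j).1 (rowTable.get i).1) &&
      listIsZero (listSub (rowTable.get j).2.1 (rowTable.get i).2.1) &&
      listIsZero (listSub (rowTable.get j).2.2.1 (rowTable.get i).2.2.1) &&
      listIsZero (listSub (rowTable.get j).2.2.2 (rowTable.get i).2.2.2) ||
    (listIsZero (listAdd (rowTable.get j).1 (rowTable.get i).1) &&
      listIsZero (listAdd (rowTable.get j).2.1 (rowTable.get i).2.1) &&
      listIsZero (listAdd (rowTable.get j).2.2.1 (rowTable.get i).2.2.1) &&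
      listIsZero (listAdd (rowTable.get j).2.2.2 (rowTable.get i).2.2.2))) = true → i = j := by
  decide +kernel

theorem mk_rowElement_injective :
    Function.Injective fun i => Quotient.mk pmSetoid (rowElement i) := by
  intro i j hij
  have h : listRow (rowTable.get j) = listRow (rowTable.get i) ∨
      listRow (rowTable.get j) = -listRow (rowTable.get i) := by
    rw [← rowData_rowElement, ← rowData_rowElement, ← rowData_neg]
    exact (Quotient.exact hij).imp (congrArg rowData) (congrArg rowData)
  apply eq_of_listIsZero i j
  simpa [-List.get_eq_getElem, listIsZero_iff, listPoly_sub, listPoly_add, sub_eq_zero,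
    add_eq_zero_iff_eq_neg, listRow, and_assoc] using h

theorem neg_mem_Gamma0TTT {g : Matrix (Fin 2) (Fin 2) (ZMod 3)[X]} (hg : g ∈ Gamma0TTT) :
    -g ∈ Gamma0TTT := by
  obtain ⟨⟨u, hu, h⟩, hd⟩ := hg
  refine ⟨⟨u, hu, ?_⟩, ?_⟩
  · rw [← h, det_fin_two, det_fin_two]; simp
  · rwa [neg_apply, dvd_neg]

theorem exists_mk_rowElement (g : Gamma0TTT) (h : fstDegree g.val + sndDegree g.val ≤ 4) :
    ∃ i, Quotient.mk pmSetoid (rowElement i) = Quotient.mk pmSetoid g := by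
  obtain ⟨t, ht, h⟩ := exists_row_of_degree_le g.2 h
  obtain ⟨i, rfl⟩ := List.mem_iff_get.1 ht
  refine ⟨i, Quotient.sound ?_⟩
  rw [← rowData_rowElement, ← rowData_neg] at h
  exact h.imp (fun h => rowData_injOn g.2 (rowElement i).2 h)
    (fun h => rowData_injOn g.2 (neg_mem_Gamma0TTT (rowElement i).2) h)

end Table

section Value

/-- Product of two pairs of coefficient lists, seen as elements of `𝔽₃[T][ρ]`. -/
def pairMul (x y : List (ZMod 3) × List (ZMod 3)) : List (ZMod 3) × List (ZMod 3) :=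
  (listAdd (listMul x.1 y.2) (listMul x.2 y.1), listSub (listMul x.2 y.2) (listMul x.1 y.1))

/-- Product of a list of pairs of coefficient lists. -/
def pairProd : List (List (ZMod 3) × List (ZMod 3)) → List (ZMod 3) × List (ZMod 3)
  | [] => ([], [1])
  | x :: l => pairMul x (pairProd l)

/-- Numerator of the factor with the given rows. -/
def numPair (t : List (ZMod 3) × List (ZMod 3) × List (ZMod 3) × List (ZMod 3)) :
    List (ZMod 3) × List (ZMod 3) :=
  pairMul (fstList t, sndList t)
    (listAdd (listMul t.1 beta11) (listMul t.2.1 beta21),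
      listAdd (listMul t.1 beta12) (listMul t.2.1 beta22))

/-- Denominator of the factor with the given rows. -/
def denPair (t : List (ZMod 3) × List (ZMod 3) × List (ZMod 3) × List (ZMod 3)) :
    List (ZMod 3) × List (ZMod 3) :=
  pairMul (t.1, t.2.1) (t.2.2.1, t.2.2.2)

/-- Numerator of the product of the factors in `rowTable`. -/
def tableNum : List (ZMod 3) × List (ZMod 3) := pairProd (rowTable.map numPair)

/-- Denominator of the product of the factors in `rowTable`. -/
def tableDen : List (ZMod 3) × List (ZMod 3) := pairProd (rowTable.map denPair)

/-- Coefficients of `T⁵ N - (T + 2) M`, where `N / M` is the product over `rowTable`. -/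
def tableDiff : List (ZMod 3) × List (ZMod 3) :=
  (listSub (listMul [0, 0, 0, 0, 0, 1] tableNum.1) (listMul [2, 1] tableDen.1),
    listSub (listMul [0, 0, 0, 0, 0, 1] tableNum.2) (listMul [2, 1] tableDen.2))

theorem tableNum_degree : listIsZero (tableNum.1.drop 48) = true ∧
    listIsZero (tableNum.2.drop 48) = true := by
  decide +kernel

theorem tableDen_degree : listIsZero (tableDen.1.drop 52) = true ∧
    listIsZero (tableDen.2.drop 52) = true ∧
    (tableDen.1.getD 51 0 ≠ 0 ∨ tableDen.2.getD 51 0 ≠ 0) := by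
  decide +kernel

theorem tableDiff_degree : listIsZero (tableDiff.1.drop 51) = true ∧
    listIsZero (tableDiff.2.drop 51) = true := by
  decide +kernel

theorem natDegree_listPoly_le_of_drop {l : List (ZMod 3)} {k : ℕ}
    (h : listIsZero (l.drop (k + 1)) = true) : (listPoly l).natDegree ≤ k := by
  rw [natDegree_le_iff_coeff_eq_zero]
  intro n hn
  rw [coeff_listPoly]
  obtain ⟨m, rfl⟩ := Nat.exists_eq_add_of_lt hn
  have h' := congrArg (fun p => p.coeff m) ((listIsZero_iff _).1 h)
  simp only [coeff_listPoly, coeff_zero, List.getD_eq_getElem?_getD, List.getElem?_drop] at h'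
  rw [List.getD_eq_getElem?_getD, ← h']
  congr 2
  omega

variable {𝕂 : Type*} [NormedField 𝕂] [Algebra (LaurentSeries (ZMod 3)) 𝕂]

/-- The element of `𝕂` given by a pair of coefficient lists. -/
noncomputable def pairForm (ρ : 𝕂) (x : List (ZMod 3) × List (ZMod 3)) : 𝕂 :=
  linForm ρ (listPoly x.1) (listPoly x.2)

theorem pairForm_mul {ρ : 𝕂} (hρ : ρ ^ 2 + 1 = 0) (x y : List (ZMod 3) × List (ZMod 3)) :
    pairForm ρ (pairMul x y) = pairForm ρ x * pairForm ρ y := by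
  simp only [pairForm, pairMul, linForm, listPoly_add, listPoly_sub, listPoly_mul, map_add, map_sub,
    map_mul]
  linear_combination -(polyEmb3 𝕂 (listPoly x.1) * polyEmb3 𝕂 (listPoly y.1)) * hρ

theorem pairForm_prod {ρ : 𝕂} (hρ : ρ ^ 2 + 1 = 0) (l : List (List (ZMod 3) × List (ZMod 3))) :
    pairForm ρ (pairProd l) = (l.map (pairForm ρ)).prod := by
  induction l with
  | nil => simp [pairProd, pairForm, linForm, listPoly]
  | cons x l ih => rw [pairProd, pairForm_mul hρ, ih, List.map_cons, List.prod_cons]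

theorem factor_rowElement (hna : ∀ x y : 𝕂, ‖x + y‖ ≤ max ‖x‖ ‖y‖)
    (hext : ∀ x : LaurentSeries (ZMod 3), ‖algebraMap (LaurentSeries (ZMod 3)) 𝕂 x‖ = absK3 x)
    {ρ ω s : 𝕂} (hρ : ρ ^ 2 + 1 = 0) (hω : ω = (polyEmb3 𝕂 X)⁻¹ ^ 2 * ρ)
    (hs : s = (polyEmb3 𝕂 X)⁻¹ ^ 2) (i : Fin rowTable.length) :
    (s - act3 (rowElement i).val ω) / (s - act3 (rowElement i).val (act3 alpha3 ω)) =
      pairForm ρ (numPair (rowTable.get i)) / pairForm ρ (denPair (rowTable.get i)) := by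
  rw [factor_eq hna hext hρ hω hs (rowElement i).2, relFst_eq, relSnd_eq]
  have h3 : lowEntry (rowElement i).val = (rowData (rowElement i).val).1 := rfl
  have h4 : (rowElement i).val 1 1 = (rowData (rowElement i).val).2.1 := rfl
  rw [h3, h4, rowData_rowElement, numPair, denPair, pairForm_mul hρ, pairForm_mul hρ]
  simp only [listRow, pairForm, fstList, sndList, listPoly_sub, listPoly_add, listPoly_mul, betaFst,
    betaSnd]

theorem norm_prod_factor (hna : ∀ x y : 𝕂, ‖x + y‖ ≤ max ‖x‖ ‖y‖)
    (hext : ∀ x : LaurentSeries (ZMod 3), ‖algebraMap (LaurentSeries (ZMod 3)) 𝕂 x‖ = absK3 x)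
    {ρ ω s : 𝕂} (hρ : ρ ^ 2 + 1 = 0) (hω : ω = (polyEmb3 𝕂 X)⁻¹ ^ 2 * ρ)
    (hs : s = (polyEmb3 𝕂 X)⁻¹ ^ 2) {z : 𝕂}
    (hz : z = ∏ i, (s - act3 (rowElement i).val ω) /
      (s - act3 (rowElement i).val (act3 alpha3 ω))) :
    ‖z‖ ≤ 3⁻¹ ^ 4 ∧
      ‖z - ((polyEmb3 𝕂 X)⁻¹ ^ 4 + 2 * (polyEmb3 𝕂 X)⁻¹ ^ 5)‖ ≤ 3⁻¹ ^ 6 := by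
  have hz' : z = pairForm ρ tableNum / pairForm ρ tableDen := by
    rw [hz, tableNum, tableDen, pairForm_prod hρ, pairForm_prod hρ, List.map_map, List.map_map,
      ← Fin.prod_univ_fun_getElem, ← Fin.prod_univ_fun_getElem, ← Finset.prod_div_distrib]
    exact Finset.prod_congr rfl fun i _ => factor_rowElement hna hext hρ hω hs i
  have hX : polyEmb3 𝕂 X ≠ 0 := by
    rw [← norm_ne_zero_iff, norm_polyEmb3_X hext]; norm_num
  have hden : ‖pairForm ρ tableDen‖ = 3 ^ 51 :=
    norm_linForm hna hext hρ (natDegree_listPoly_le_of_drop tableDen_degree.1)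
      (natDegree_listPoly_le_of_drop tableDen_degree.2.1)
      (by simpa only [coeff_listPoly] using tableDen_degree.2.2)
  have hnum : ‖pairForm ρ tableNum‖ ≤ 3 ^ 47 :=
    norm_linForm_le hna hext hρ (natDegree_listPoly_le_of_drop tableNum_degree.1)
      (natDegree_listPoly_le_of_drop tableNum_degree.2)
  have hdiff : ‖pairForm ρ tableDiff‖ ≤ 3 ^ 50 :=
    norm_linForm_le hna hext hρ (natDegree_listPoly_le_of_drop tableDiff_degree.1)
      (natDegree_listPoly_le_of_drop tableDiff_degree.2)
  have hden0 : pairForm ρ tableDen ≠ 0 := by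
    rw [← norm_ne_zero_iff, hden]; positivity
  have hdiff' : pairForm ρ tableDiff = polyEmb3 𝕂 X ^ 5 * pairForm ρ tableNum -
      (polyEmb3 𝕂 X + 2) * pairForm ρ tableDen := by
    have h2 : polyEmb3 𝕂 (Polynomial.C 2) = 2 := by
      rw [map_ofNat Polynomial.C 2, map_ofNat]
    simp only [pairForm, tableDiff, linForm, listPoly_sub, listPoly_mul, map_sub, map_mul, map_add,
      listPoly, map_zero, map_one, h2]
    ring
  have hz2 : z - ((polyEmb3 𝕂 X)⁻¹ ^ 4 + 2 * (polyEmb3 𝕂 X)⁻¹ ^ 5) =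
      pairForm ρ tableDiff / (polyEmb3 𝕂 X ^ 5 * pairForm ρ tableDen) := by
    rw [hz', hdiff']
    field_simp
  constructor
  · rw [hz', norm_div, hden, div_le_iff₀ (by positivity)]
    exact hnum.trans (by norm_num)
  · rw [hz2, norm_div, norm_mul, norm_pow, norm_polyEmb3_X hext, hden,
      div_le_iff₀ (by positivity)]
    exact hdiff.trans (by norm_num)

end Value

/-- **Part of the Proposition in Section 8.2.**  With `ω = T⁻²·ρ` (`ρ² + 1 = 0`), the
family `γ ↦ (1/T² - γω)/(1/T² - γ(αω))`, indexed by `Γ~ = Γ/{±I}`, is multipliable,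
and its product `u_α(1/T²)` satisfies `|u_α(1/T²) - (π⁴ + 2π⁵)| < 3⁻⁵`, `π = 1/T`. -/
theorem u_alpha3_at_one_over_T_sq {C : Type*} [NormedField C] [CompleteSpace C]
    [Algebra (LaurentSeries (ZMod 3)) C]
    (hna : ∀ x y : C, ‖x + y‖ ≤ max ‖x‖ ‖y‖)
    (hext : ∀ x : LaurentSeries (ZMod 3), ‖algebraMap (LaurentSeries (ZMod 3)) C x‖ = absK3 x)
    (ρ : C) (hρ : ρ ^ 2 + 1 = 0)
    (ω : C) (hω : ω = (polyEmb3 C Polynomial.X)⁻¹ ^ 2 * ρ)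
    (s : C) (hs : s = (polyEmb3 C Polynomial.X)⁻¹ ^ 2)
    (f : Quotient pmSetoid → C)
    (hf : ∀ γ : ↥Gamma0TTT, f (Quotient.mk pmSetoid γ)
      = (s - act3 γ.val ω) / (s - act3 γ.val (act3 alpha3 ω))) :
    Multipliable f ∧
    ‖(∏' x, f x) - ((polyEmb3 C Polynomial.X)⁻¹ ^ 4 + 2 * (polyEmb3 C Polynomial.X)⁻¹ ^ 5)‖ < (3 : ℝ) ^ (-5 : ℤ) := by
  have hmk : ∀ x, ∃ g : Gamma0TTT, Quotient.mk pmSetoid g = x := Quotient.exists_rep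
  have hnorm : ∀ g : Gamma0TTT, ‖f (Quotient.mk pmSetoid g) - 1‖ =
      3 ^ 3 / 3 ^ (fstDegree g.val + sndDegree g.val) := fun g => by
    rw [hf, norm_factor_sub_one hna hext hρ hω hs g.2]
  have hfin : ∀ ε > 0, {x | ε < ‖f x - 1‖}.Finite := by
    intro ε hε
    obtain ⟨N, hN⟩ := pow_unbounded_of_one_lt (3 ^ 3 / ε) (by norm_num : (1 : ℝ) < 3)
    refine ((finite_degree_le N).image (Quotient.mk pmSetoid)).subset fun x hx => ?_
    obtain ⟨g, rfl⟩ := hmk x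
    have hx' : ε < 3 ^ 3 / 3 ^ (fstDegree g.val + sndDegree g.val) := (hnorm g) ▸ hx
    rw [lt_div_iff₀ (by positivity), mul_comm, ← lt_div_iff₀ hε] at hx'
    have h := (pow_lt_pow_iff_right₀ (by norm_num : (1 : ℝ) < 3)).1 (hx'.trans hN)
    exact ⟨g, ⟨by omega, by omega⟩, rfl⟩
  have hfar : ∀ x ∉ Finset.univ.image fun i => Quotient.mk pmSetoid (rowElement i),
      ‖f x - 1‖ ≤ 3⁻¹ ^ 2 := by
    intro x hx
    obtain ⟨g, rfl⟩ := hmk x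
    have hg : 5 ≤ fstDegree g.val + sndDegree g.val := by
      by_contra hlt
      obtain ⟨i, hi⟩ := exists_mk_rowElement g (by omega)
      exact hx (Finset.mem_image.2 ⟨i, Finset.mem_univ i, hi⟩)
    rw [hnorm, div_le_iff₀ (by positivity)]
    calc (3 : ℝ) ^ 3 = 3⁻¹ ^ 2 * 3 ^ 5 := by norm_num
      _ ≤ 3⁻¹ ^ 2 * 3 ^ (fstDegree g.val + sndDegree g.val) := by gcongr; norm_num
  obtain ⟨hmul, herr⟩ := multipliable_and_norm_tprod_sub_prod_le hna f hfin _ (by positivity)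
    (by norm_num) hfar
  refine ⟨hmul, ?_⟩
  rw [Finset.prod_image fun i _ j _ h => mk_rowElement_injective h] at herr
  obtain ⟨h1, h2⟩ := norm_prod_factor hna hext hρ hω hs
    (z := ∏ i, f (Quotient.mk pmSetoid (rowElement i)))
    (Finset.prod_congr rfl fun i _ => hf (rowElement i))
  have h3 := herr.trans (mul_le_mul_of_nonneg_right h1 (by positivity))
  rw [← sub_add_sub_cancel _ (∏ i, f (Quotient.mk pmSetoid (rowElement i)))]
  refine (hna _ _).trans_lt (max_lt (h3.trans_lt ?_) (h2.trans_lt ?_)) <;> norm_num
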